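/- Let F be a self-similar set in ℝ^d that is not contained in any (d−1)-dimensional hyperplane. If the defining IFS satisfies the weak separation property, then the Assouad dimension of F equals its Hausdorff dimension; if the defining IFS does not satisfy the weak separation property, then the Assouad dimension of F is at least 1. -/

import Mathlib

open Set Metric Filter Function MeasureTheory

/-- The Assouad dimension of a subset of a metric space: the infimum of all `s ≥ 0`
for which there is a constant `K > 0` such that for all `0 < ρ < r ≤ 1`, every ball
of radius `r` centred in the set can be covered by at most `K (r/ρ)^s` open balls of
radius `ρ`. -/
noncomputable def assouadDim {X : Type*} [MetricSpace X] (A : Set X) : ℝ :=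
  sInf {s : ℝ | 0 ≤ s ∧ ∃ K : ℝ, 0 < K ∧ ∀ r ρ : ℝ, 0 < ρ → ρ < r → r ≤ 1 →
    ∀ x ∈ A, ∃ t : Finset X, (A ∩ Metric.ball x r ⊆ ⋃ y ∈ t, Metric.ball y ρ) ∧
      (t.card : ℝ) ≤ K * (r / ρ) ^ s}

/-- The composition `S_{i₁} ∘ ⋯ ∘ S_{i_k}` associated to a finite word. -/
def wordMap {ι X : Type*} (S : ι → X → X) : List ι → X → X
  | [] => id
  | i :: w => S i ∘ wordMap S w

/-- The weak separation property: the identity is not in the closure (for the topology of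
pointwise convergence) of the set of maps `S_α⁻¹ ∘ S_β` for distinct nonempty words
`α ≠ β`, with the identity itself removed. -/
def SatisfiesWSP {ι X : Type*} [Nonempty X] [TopologicalSpace X] (S : ι → X → X) : Prop :=
  id ∉ closure ({g : X → X | ∃ w₁ w₂ : List ι, w₁ ≠ [] ∧ w₂ ≠ [] ∧ w₁ ≠ w₂ ∧
      g = Function.invFun (wordMap S w₁) ∘ wordMap S w₂} \ {id})

/-- `s` is an admissible exponent in the definition of the Assouad dimension of `A`. -/
def IsAssouadExponent {X : Type*} [MetricSpace X] (A : Set X) (s : ℝ) : Prop :=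
  0 ≤ s ∧ ∃ K : ℝ, 0 < K ∧ ∀ r ρ : ℝ, 0 < ρ → ρ < r → r ≤ 1 →
    ∀ x ∈ A, ∃ t : Finset X, (A ∩ Metric.ball x r ⊆ ⋃ y ∈ t, Metric.ball y ρ) ∧
      (t.card : ℝ) ≤ K * (r / ρ) ^ s

theorem assouadDim_eq_sInf {X : Type*} [MetricSpace X] (A : Set X) :
    assouadDim A = sInf {s | IsAssouadExponent A s} := rfl

theorem assouadDim_le {X : Type*} [MetricSpace X] {A : Set X} {s : ℝ}
    (hs : IsAssouadExponent A s) : assouadDim A ≤ s :=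
  csInf_le ⟨0, fun _ h => h.1⟩ hs

theorem le_assouadDim {X : Type*} [MetricSpace X] {A : Set X} {a s : ℝ}
    (hs : IsAssouadExponent A s) (h : ∀ s, IsAssouadExponent A s → a ≤ s) : a ≤ assouadDim A :=
  le_csInf ⟨s, hs⟩ h

section Covering

variable {X : Type*} [MetricSpace X]

theorem TotallyBounded.exists_finset_cover {A : Set X} (hA : TotallyBounded A) {δ : ℝ}
    (hδ : 0 < δ) : ∃ T : Finset X, A ⊆ ⋃ y ∈ T, ball y δ := by
  obtain ⟨t, ht, h⟩ := Metric.totallyBounded_iff.1 hA δ hδ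
  exact ⟨ht.toFinset, by simpa using h⟩

/-- A set covered by contracted copies of itself, with contraction ratios whose `t`-th powers sum
to at most one, has upper box dimension at most `t`. -/
theorem exists_cover_card_le_of_subset_iUnion_image {J : Type*} {A : Set X} (W : Finset J)
    (f : J → X → X) (c : J → ℝ) (hc : ∀ j ∈ W, c j ∈ Ioo (0 : ℝ) 1)
    (hf : ∀ j ∈ W, ∀ x y, dist (f j x) (f j y) ≤ c j * dist x y)
    (hA : TotallyBounded A) (hAW : A ⊆ ⋃ j ∈ W, f j '' A) {t : ℝ} (ht : 0 ≤ t)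
    (hsum : ∑ j ∈ W, c j ^ t ≤ 1) :
    ∃ K : ℝ, 0 < K ∧ ∀ δ : ℝ, 0 < δ → δ < 1 →
      ∃ T : Finset X, A ⊆ (⋃ y ∈ T, ball y δ) ∧ (T.card : ℝ) ≤ K * (1 / δ) ^ t := by
  classical
  rcases W.eq_empty_or_nonempty with rfl | hW
  · refine ⟨1, one_pos, fun δ hδ _ => ⟨∅, by simpa using hAW, ?_⟩⟩
    simp only [Finset.card_empty, Nat.cast_zero]
    positivity
  obtain ⟨jm, hjm, hm⟩ := W.exists_min_image c hW
  obtain ⟨jM, hjM, hM⟩ := W.exists_max_image c hW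
  set m := c jm with hm_def
  set M := c jM with hM_def
  have hm0 : 0 < m := (hc jm hjm).1
  have hM0 : 0 < M := (hc jM hjM).1
  have hM1 : M < 1 := (hc jM hjM).2
  obtain ⟨T₀, hT₀⟩ := hA.exists_finset_cover one_pos
  have hK : 0 < ((T₀.card : ℝ) + 1) * (1 / m) ^ t := by positivity
  set K := ((T₀.card : ℝ) + 1) * (1 / m) ^ t with hK_def
  refine ⟨K, hK, ?_⟩
  have large : ∀ δ : ℝ, 1 ≤ δ → δ ≤ 1 / m →
      ∃ T : Finset X, A ⊆ (⋃ y ∈ T, ball y δ) ∧ (T.card : ℝ) ≤ K * (1 / δ) ^ t := by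
    intro δ h1 h2
    refine ⟨T₀, hT₀.trans (iUnion₂_mono fun y _ => ball_subset_ball h1), ?_⟩
    have hδ : 0 < δ := by linarith
    have : 1 ≤ (1 / m * (1 / δ)) ^ t := by
      apply Real.one_le_rpow _ ht
      rw [mul_one_div, le_div_iff₀ hδ]
      linarith
    rw [hK_def, mul_assoc, ← Real.mul_rpow (by positivity) (by positivity)]
    nlinarith [(Nat.cast_nonneg T₀.card : (0 : ℝ) ≤ T₀.card)]
  have key : ∀ n : ℕ, ∀ δ : ℝ, M ^ n ≤ δ → δ ≤ 1 / m →
      ∃ T : Finset X, A ⊆ (⋃ y ∈ T, ball y δ) ∧ (T.card : ℝ) ≤ K * (1 / δ) ^ t := by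
    intro n
    induction n with
    | zero => intro δ h1 h2; exact large δ (by simpa using h1) h2
    | succ n ih =>
      intro δ h1 h2
      by_cases hδ1 : 1 ≤ δ
      · exact large δ hδ1 h2
      push Not at hδ1
      have hδ : 0 < δ := lt_of_lt_of_le (by positivity) h1
      have step : ∀ j ∈ W, ∃ T : Finset X, A ⊆ (⋃ y ∈ T, ball y (δ / c j)) ∧
          (T.card : ℝ) ≤ K * (1 / (δ / c j)) ^ t := by
        intro j hj
        have hcj := (hc j hj).1
        apply ih
        · rw [le_div_iff₀ hcj]
          calc M ^ n * c j ≤ M ^ n * M := by gcongr; exact hM j hj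
            _ ≤ δ := by rw [← pow_succ]; exact h1
        · exact div_le_div₀ zero_le_one hδ1.le hm0 (hm j hj)
      choose! T hT hTc using step
      refine ⟨W.biUnion fun j => (T j).image (f j), ?_, ?_⟩
      · intro x hx
        obtain ⟨j, hj, a, ha, rfl⟩ := by simpa only [mem_iUnion, exists_prop] using hAW hx
        obtain ⟨y, hy, hay⟩ := by simpa only [mem_iUnion, exists_prop] using hT j hj ha
        simp only [mem_iUnion, exists_prop, Finset.mem_biUnion, Finset.mem_image]
        refine ⟨f j y, ⟨j, hj, y, hy, rfl⟩, ?_⟩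
        rw [mem_ball] at hay ⊢
        rw [lt_div_iff₀ (hc j hj).1] at hay
        linarith [hf j hj a y]
      · calc ((W.biUnion fun j => (T j).image (f j)).card : ℝ)
            ≤ ∑ j ∈ W, ((T j).card : ℝ) := by
              exact_mod_cast Finset.card_biUnion_le.trans
                (Finset.sum_le_sum fun j _ => Finset.card_image_le)
          _ ≤ ∑ j ∈ W, K * (1 / δ) ^ t * c j ^ t := by
              refine Finset.sum_le_sum fun j hj => (hTc j hj).trans (le_of_eq ?_)
              have hcj := (hc j hj).1
              rw [mul_assoc K, ← Real.mul_rpow (by positivity) hcj.le]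
              congr 2
              field_simp
          _ = K * (1 / δ) ^ t * ∑ j ∈ W, c j ^ t := by rw [Finset.mul_sum]
          _ ≤ K * (1 / δ) ^ t := mul_le_of_le_one_right (by positivity) hsum
  intro δ hδ hδ1
  obtain ⟨n, hn⟩ := exists_pow_lt_of_lt_one hδ hM1
  refine key n δ hn.le (hδ1.le.trans ?_)
  rw [le_div_iff₀ hm0]
  linarith [(hc jm hjm).2]

/-- A compact set of vanishing Hausdorff measure has finite covers by balls with small
power sum of the radii. -/
theorem IsCompact.exists_finite_cover_sum_rpow_le [MeasurableSpace X] [BorelSpace X] {A : Set X}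
    (hA : IsCompact A) (hne : A.Nonempty) {t : ℝ} (ht : 0 < t) (h0 : μH[t] A = 0) {η : ℝ} (hη : 0 < η) :
    ∃ (I : Finset ℕ) (x : ℕ → X) (r : ℕ → ℝ), (∀ n, 0 < r n) ∧
      A ⊆ (⋃ n ∈ I, ball (x n) (r n)) ∧ ∑ n ∈ I, r n ^ t ≤ η := by
  obtain ⟨x₀, -⟩ := hne
  have hη2 : ENNReal.ofReal (η / 2) ≠ 0 := by simpa using hη
  have hinf : (⨅ (T : ℕ → Set X) (_ : A ⊆ ⋃ n, T n) (_ : ∀ n, ediam (T n) ≤ 1),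
      ∑' n, ⨆ _ : (T n).Nonempty, ediam (T n) ^ t) < ENNReal.ofReal (η / 2) := by
    rw [Measure.hausdorffMeasure_apply] at h0
    have := (le_iSup₂ (f := fun (r : ENNReal) (_ : 0 < r) =>
      ⨅ (T : ℕ → Set X) (_ : A ⊆ ⋃ n, T n) (_ : ∀ n, ediam (T n) ≤ r),
        ∑' n, ⨆ _ : (T n).Nonempty, ediam (T n) ^ t) 1 one_pos).trans h0.le
    exact lt_of_le_of_lt this (pos_iff_ne_zero.2 hη2)
  simp only [iInf_lt_iff] at hinf
  obtain ⟨T, hAT, -, hT⟩ := hinf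
  obtain ⟨ε, hε, hεsum⟩ := ENNReal.exists_pos_sum_of_countable hη2 ℕ
  set s : ℕ → ENNReal := fun n => (⨆ _ : (T n).Nonempty, ediam (T n) ^ t) + ε n with hs_def
  have hs : ∑' n, s n ≤ ENNReal.ofReal η := by
    rw [ENNReal.tsum_add]
    calc _ ≤ ENNReal.ofReal (η / 2) + ENNReal.ofReal (η / 2) := add_le_add hT.le hεsum.le
      _ = ENNReal.ofReal η := by rw [← ENNReal.ofReal_add (by linarith) (by linarith)]; ring_nf
  have hs_top : ∀ n, s n ≠ ⊤ := ENNReal.ne_top_of_tsum_ne_top (ne_top_of_le_ne_top (by simp) hs)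
  have hs_pos : ∀ n, 0 < (s n).toReal := fun n =>
    ENNReal.toReal_pos (ne_of_gt (lt_of_lt_of_le (by exact_mod_cast hε n) le_add_self)) (hs_top n)
  have hx : ∀ n, ∃ x, (T n).Nonempty → x ∈ T n := fun n => by
    by_cases h : (T n).Nonempty
    · exact ⟨h.some, fun _ => h.some_mem⟩
    · exact ⟨x₀, fun h' => absurd h' h⟩
  choose x hx using hx
  set r : ℕ → ℝ := fun n => (s n).toReal ^ (1 / t) with hr_def
  have hTr : ∀ n, T n ⊆ ball (x n) (r n) := by
    intro n y hy
    have hne : (T n).Nonempty := ⟨y, hy⟩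
    have h1 : edist y (x n) ≤ ediam (T n) := edist_le_ediam_of_mem hy (hx n hne)
    have h2 : ediam (T n) ^ t < s n := by
      have : (⨆ _ : (T n).Nonempty, ediam (T n) ^ t) = ediam (T n) ^ t := by simp [hne]
      simp only [hs_def, this]
      refine ENNReal.lt_add_right ?_ (by exact_mod_cast (hε n).ne')
      have h3 := hs_top n
      simp only [hs_def, this] at h3
      exact ne_top_of_le_ne_top h3 le_self_add
    have h3 : edist y (x n) ^ t < s n := (ENNReal.rpow_le_rpow h1 ht.le).trans_lt h2
    rw [edist_dist, ENNReal.ofReal_rpow_of_nonneg dist_nonneg ht.le,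
      ENNReal.ofReal_lt_iff_lt_toReal (by positivity) (hs_top n)] at h3
    rw [mem_ball]
    calc dist y (x n) = (dist y (x n) ^ t) ^ (1 / t) := by
          rw [← Real.rpow_mul dist_nonneg, mul_one_div_cancel ht.ne', Real.rpow_one]
      _ < r n := Real.rpow_lt_rpow (by positivity) h3 (by positivity)
  obtain ⟨I, hI⟩ := hA.elim_finite_subcover (fun n => ball (x n) (r n)) (fun _ => isOpen_ball)
    (hAT.trans (iUnion_mono hTr))
  refine ⟨I, x, r, fun n => Real.rpow_pos_of_pos (hs_pos n) _, hI, ?_⟩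
  calc ∑ n ∈ I, r n ^ t = ∑ n ∈ I, (s n).toReal := Finset.sum_congr rfl fun n _ => by
        rw [← Real.rpow_mul (hs_pos n).le, one_div_mul_cancel ht.ne', Real.rpow_one]
    _ = (∑ n ∈ I, s n).toReal := (ENNReal.toReal_sum fun n _ => hs_top n).symm
    _ ≤ (ENNReal.ofReal η).toReal :=
        ENNReal.toReal_mono ENNReal.ofReal_ne_top ((ENNReal.sum_le_tsum I).trans hs)
    _ = η := ENNReal.toReal_ofReal hη.le

/-- Every admissible exponent for the Assouad dimension bounds the Hausdorff dimension. -/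
theorem IsAssouadExponent.dimH_le {A : Set X} (hA : IsCompact A) {s : ℝ}
    (hs : IsAssouadExponent A s) : dimH A ≤ ENNReal.ofReal s := by
  classical
  borelize X
  obtain ⟨hs0, K, hK, h⟩ := hs
  obtain ⟨T₀, hT₀A, hT₀, hT₀c⟩ := hA.finite_cover_balls one_pos
  have hρ : ∀ n : ℕ, 0 < 1 / ((n : ℝ) + 2) ∧ 1 / ((n : ℝ) + 2) < 1 := fun n => by
    have : (0 : ℝ) ≤ n := n.cast_nonneg
    exact ⟨by positivity, by rw [div_lt_one (by positivity)]; linarith⟩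
  have h' : ∀ (n : ℕ) (x : X), ∃ t : Finset X, x ∈ T₀ →
      (A ∩ ball x 1 ⊆ ⋃ y ∈ t, ball y (1 / ((n : ℝ) + 2))) ∧
      (t.card : ℝ) ≤ K * ((n : ℝ) + 2) ^ s := by
    intro n x
    by_cases hx : x ∈ T₀
    · obtain ⟨t, ht⟩ := h 1 _ (hρ n).1 (hρ n).2 le_rfl x (hT₀A hx)
      exact ⟨t, fun _ => by simpa using ht⟩
    · exact ⟨∅, fun h => absurd h hx⟩
  choose t ht using h'
  set u : ℕ → Finset X := fun n => hT₀.toFinset.biUnion (t n)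
  have hu : ∀ n, (u n).card ≤ hT₀.toFinset.card * (K * ((n : ℝ) + 2) ^ s) := fun n => by
    calc ((u n).card : ℝ) ≤ ∑ x ∈ hT₀.toFinset, ((t n x).card : ℝ) := by
          exact_mod_cast Finset.card_biUnion_le
      _ ≤ ∑ x ∈ hT₀.toFinset, K * ((n : ℝ) + 2) ^ s :=
          Finset.sum_le_sum fun x hx => (ht n x (by simpa using hx)).2
      _ = _ := by rw [Finset.sum_const, nsmul_eq_mul]
  have hdiam : ∀ (n : ℕ) (y : X),
      ediam (ball y (1 / ((n : ℝ) + 2))) ≤ ENNReal.ofReal (2 / ((n : ℝ) + 2)) := fun n y => by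
    refine ediam_le fun a ha b hb => ?_
    rw [edist_dist]
    apply ENNReal.ofReal_le_ofReal
    rw [mem_ball] at ha hb
    have := dist_triangle_right a b y
    have e : 2 / ((n : ℝ) + 2) = 1 / ((n : ℝ) + 2) + 1 / ((n : ℝ) + 2) := by ring
    linarith
  have hlim : Tendsto (fun n : ℕ => ENNReal.ofReal (2 / ((n : ℝ) + 2))) atTop (nhds 0) := by
    rw [← ENNReal.ofReal_zero]
    refine ENNReal.tendsto_ofReal ?_
    exact tendsto_const_nhds.div_atTop
      (tendsto_atTop_add_const_right _ _ tendsto_natCast_atTop_atTop)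
  have hμ := Measure.hausdorffMeasure_le_liminf_sum (ι := fun n => u n) s A _ hlim
    (fun n y => ball (y : X) (1 / ((n : ℝ) + 2)))
    (Eventually.of_forall fun n y => hdiam n y) (Eventually.of_forall fun n a ha => by
      obtain ⟨x, hx, hax⟩ := by simpa only [mem_iUnion, exists_prop] using hT₀c ha
      obtain ⟨y, hy, hay⟩ := by
        simpa only [mem_iUnion, exists_prop] using (ht n x hx).1 ⟨ha, hax⟩
      exact mem_iUnion.2 ⟨⟨y, Finset.mem_biUnion.2 ⟨x, by simpa using hx, hy⟩⟩, hay⟩)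
  have hbd : ∀ n : ℕ, ∑ y : u n, ediam (ball (y : X) (1 / ((n : ℝ) + 2))) ^ s ≤
      ENNReal.ofReal (hT₀.toFinset.card * K * 2 ^ s) := fun n => by
    calc ∑ y : u n, ediam (ball (y : X) (1 / ((n : ℝ) + 2))) ^ s
        ≤ ∑ y : u n, ENNReal.ofReal ((2 / ((n : ℝ) + 2)) ^ s) := by
          refine Finset.sum_le_sum fun y _ => ?_
          rw [← ENNReal.ofReal_rpow_of_nonneg (by positivity) hs0]
          exact ENNReal.rpow_le_rpow (hdiam n y) hs0
      _ = ENNReal.ofReal ((u n).card * (2 / ((n : ℝ) + 2)) ^ s) := by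
          rw [Finset.sum_const, Finset.card_univ, Fintype.card_coe, nsmul_eq_mul,
            ENNReal.ofReal_mul (by positivity), ENNReal.ofReal_natCast]
      _ ≤ _ := by
          apply ENNReal.ofReal_le_ofReal
          calc ((u n).card : ℝ) * (2 / ((n : ℝ) + 2)) ^ s
              ≤ hT₀.toFinset.card * (K * ((n : ℝ) + 2) ^ s) * (2 / ((n : ℝ) + 2)) ^ s := by
                gcongr; exact hu n
            _ = hT₀.toFinset.card * K * (((n : ℝ) + 2) * (2 / ((n : ℝ) + 2))) ^ s := by
                rw [Real.mul_rpow (by positivity) (by positivity)]; ring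
            _ = _ := by
                congr 2
                field_simp
  have hfin : μH[s] A ≠ ⊤ := ne_top_of_le_ne_top ENNReal.ofReal_ne_top
    (hμ.trans (liminf_le_of_le (by isBoundedDefault) fun b hb => by
      obtain ⟨n, hn⟩ := hb.exists
      exact hn.trans (hbd n)))
  have := dimH_le_of_hausdorffMeasure_ne_top (s := A) (d := s.toNNReal)
    (by rwa [Real.coe_toNNReal s hs0])
  simpa [ENNReal.ofReal] using this

end Covering

theorem exists_isAssouadExponent {d : ℕ} (A : Set (EuclideanSpace ℝ (Fin d))) :
    ∃ s, IsAssouadExponent A s := by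
  classical
  set E := EuclideanSpace ℝ (Fin d)
  have hB : TotallyBounded (closedBall (0 : E) 1) := (isCompact_closedBall _ _).totallyBounded
  obtain ⟨T, hT⟩ := hB.exists_finset_cover (δ := 1 / 2) (by norm_num)
  obtain ⟨K, hK, h⟩ := exists_cover_card_le_of_subset_iUnion_image T
    (fun y x : E => y + (1 / 2 : ℝ) • x) (fun _ => 1 / 2) (fun _ _ => by norm_num)
    (fun y _ a b => by simp [dist_smul₀]) hB
    (fun x hx => by
      obtain ⟨y, hy, hxy⟩ := by simpa only [mem_iUnion, exists_prop] using hT hx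
      refine mem_iUnion₂.2 ⟨y, hy, (2 : ℝ) • (x - y), ?_, by simp [smul_smul]⟩
      rw [mem_ball, dist_eq_norm] at hxy
      rw [mem_closedBall_zero_iff, norm_smul, Real.norm_ofNat]
      linarith) (t := T.card) (Nat.cast_nonneg _) (by
        rw [Finset.sum_const, nsmul_eq_mul, Real.rpow_natCast, one_div, inv_pow,
          ← div_eq_mul_inv, div_le_one (by positivity)]
        exact_mod_cast Nat.lt_two_pow_self.le)
  refine ⟨T.card, Nat.cast_nonneg _, K, hK, fun r ρ hρ hρr hr x _ => ?_⟩
  have hr0 : 0 < r := hρ.trans hρr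
  obtain ⟨U, hU, hUc⟩ := h (ρ / r) (by positivity) (by rwa [div_lt_one hr0])
  refine ⟨U.image fun z => x + r • z, ?_, ?_⟩
  · rintro a ⟨-, ha⟩
    rw [mem_ball, dist_eq_norm] at ha
    have : r⁻¹ • (a - x) ∈ closedBall (0 : E) 1 := by
      rw [mem_closedBall_zero_iff, norm_smul, norm_inv, Real.norm_of_nonneg hr0.le,
        inv_mul_le_iff₀ hr0]
      linarith
    obtain ⟨y, hy, hay⟩ := by simpa only [mem_iUnion, exists_prop] using hU this
    refine mem_iUnion₂.2 ⟨x + r • y, Finset.mem_image_of_mem _ hy, ?_⟩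
    have e : a = x + r • (r⁻¹ • (a - x)) := by simp [smul_smul, hr0.ne']
    rw [mem_ball] at hay ⊢
    rw [e, dist_add_left, dist_smul₀, Real.norm_of_nonneg hr0.le]
    rwa [lt_div_iff₀' hr0] at hay
  · refine (Nat.cast_le.2 Finset.card_image_le).trans (hUc.trans (le_of_eq ?_))
    rw [one_div_div]

/-- A similarity of Euclidean space is an affine map whose linear part is a scaled isometry. -/
theorem exists_linearIsometryEquiv_of_dist_eq {d : ℕ}
    {T : EuclideanSpace ℝ (Fin d) → EuclideanSpace ℝ (Fin d)} {c : ℝ} (hc : 0 < c)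
    (hT : ∀ x y, dist (T x) (T y) = c * dist x y) :
    ∃ L : EuclideanSpace ℝ (Fin d) ≃ₗᵢ[ℝ] EuclideanSpace ℝ (Fin d),
      ∀ x, T x = T 0 + c • L x := by
  have hi : Isometry fun x => c⁻¹ • T x := Isometry.of_dist_eq fun x y => by
    rw [dist_smul₀, hT, norm_inv, Real.norm_of_nonneg hc.le, inv_mul_cancel_left₀ hc.ne']
  refine ⟨hi.affineIsometryOfStrictConvexSpace.linearIsometry.toLinearIsometryEquiv rfl,
    fun x => ?_⟩
  have := hi.affineIsometryOfStrictConvexSpace.map_vadd 0 x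
  simp only [vadd_eq_add, add_zero, Isometry.affineIsometryOfStrictConvexSpace_apply] at this
  rw [LinearIsometry.toLinearIsometryEquiv_apply]
  have h2 := congrArg (fun z => c • z) this
  simpa [smul_smul, hc.ne', add_comm] using h2

theorem surjective_of_dist_eq {d : ℕ}
    {T : EuclideanSpace ℝ (Fin d) → EuclideanSpace ℝ (Fin d)} {c : ℝ} (hc : 0 < c)
    (hT : ∀ x y, dist (T x) (T y) = c * dist x y) : Surjective T := by
  obtain ⟨L, hL⟩ := exists_linearIsometryEquiv_of_dist_eq hc hT
  exact fun y => ⟨L.symm (c⁻¹ • (y - T 0)), by rw [hL]; simp [smul_smul, hc.ne']⟩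

theorem wordMap_append {ι X : Type*} (S : ι → X → X) (u v : List ι) (x : X) :
    wordMap S (u ++ v) x = wordMap S u (wordMap S v x) := by
  induction u with
  | nil => rfl
  | cons i u ih => exact congrArg (S i) ih

/-- The contraction ratio of the composition associated to a finite word. -/
def wordRatio {ι : Type*} (c : ι → ℝ) (w : List ι) : ℝ := (w.map c).prod

theorem wordRatio_append {ι : Type*} (c : ι → ℝ) (u v : List ι) :
    wordRatio c (u ++ v) = wordRatio c u * wordRatio c v := by simp [wordRatio]

theorem wordRatio_pos {ι : Type*} {c : ι → ℝ} (hc : ∀ i, 0 < c i) (w : List ι) :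
    0 < wordRatio c w := by
  induction w with
  | nil => simp [wordRatio]
  | cons i w ih => simpa [wordRatio] using mul_pos (hc i) ih

theorem wordRatio_le_one {ι : Type*} {c : ι → ℝ} (hc : ∀ i, 0 ≤ c i) (hc1 : ∀ i, c i ≤ 1)
    (w : List ι) : wordRatio c w ≤ 1 := by
  induction w with
  | nil => simp [wordRatio]
  | cons i w ih =>
    have h : wordRatio c (i :: w) = wordRatio c w * c i := by simp [wordRatio, mul_comm]
    exact h ▸ mul_le_one₀ ih (hc i) (hc1 i)

theorem dist_wordMap {ι X : Type*} [MetricSpace X] {S : ι → X → X} {c : ι → ℝ}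
    (hsim : ∀ i x y, dist (S i x) (S i y) = c i * dist x y) (w : List ι) (x y : X) :
    dist (wordMap S w x) (wordMap S w y) = wordRatio c w * dist x y := by
  induction w with
  | nil => simp [wordRatio, wordMap]
  | cons i w ih =>
    simp only [wordMap, comp_apply, hsim, ih]
    simp [wordRatio, mul_assoc]

theorem wordMap_mem {ι X : Type*} {S : ι → X → X} {F : Set X} (hF : F = ⋃ i, S i '' F)
    (w : List ι) {x : X} (hx : x ∈ F) : wordMap S w x ∈ F := by
  induction w with
  | nil => exact hx
  | cons i w ih =>
    rw [hF]
    exact mem_iUnion.2 ⟨i, mem_image_of_mem _ ih⟩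

/-- Every point of a self-similar set lies in a cylinder of prescribed size, up to a constant. -/
theorem exists_wordMap_eq {ι X : Type*} {S : ι → X → X} {c : ι → ℝ} {m M : ℝ}
    {F : Set X} (hF : F = ⋃ i, S i '' F) (hm : 0 < m) (hM : M < 1) (hmc : ∀ i, m ≤ c i)
    (hcM : ∀ i, c i ≤ M) {p : X} (hp : p ∈ F) {b : ℝ} (hb : 0 < b) (hb1 : b ≤ 1) :
    ∃ u, ∃ q ∈ F, wordMap S u q = p ∧ m * b ≤ wordRatio c u ∧ wordRatio c u ≤ b := by
  have hc : ∀ i, 0 < c i := fun i => hm.trans_le (hmc i)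
  have key : ∀ n : ℕ, ∃ u, ∃ q ∈ F, wordMap S u q = p ∧ m * b ≤ wordRatio c u ∧
      (wordRatio c u ≤ b ∨ wordRatio c u ≤ M ^ n) := by
    intro n
    induction n with
    | zero =>
      rw [hF, mem_iUnion] at hp
      obtain ⟨i, hi⟩ := hp
      refine ⟨[], p, by rw [hF]; exact mem_iUnion.2 ⟨i, hi⟩, rfl, ?_, Or.inr ?_⟩
      · simp only [wordRatio, List.map_nil, List.prod_nil]
        nlinarith [hmc i, hcM i]
      · simp [wordRatio]
    | succ n ih =>
      obtain ⟨u, q, hq, hu, h1, h2⟩ := ih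
      by_cases hub : wordRatio c u ≤ b
      · exact ⟨u, q, hq, hu, h1, Or.inl hub⟩
      have h2 := h2.resolve_left hub
      push Not at hub
      rw [hF] at hq
      obtain ⟨i, q', hq', rfl⟩ := mem_iUnion.1 hq
      have hi : wordRatio c [i] = c i := by simp [wordRatio]
      refine ⟨u ++ [i], q', hq', by rw [wordMap_append, ← hu]; rfl, ?_, Or.inr ?_⟩
      · rw [wordRatio_append, hi, mul_comm]
        exact mul_le_mul hub.le (hmc i) hm.le (wordRatio_pos hc u).le
      · rw [wordRatio_append, hi, pow_succ]
        exact mul_le_mul h2 (hcM i) (hc i).le ((wordRatio_pos hc u).le.trans h2)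
  have hM0 : ∃ n : ℕ, M ^ n < b := exists_pow_lt_of_lt_one hb hM
  obtain ⟨n, hn⟩ := hM0
  obtain ⟨u, q, hq, hu, h1, h2⟩ := key n
  exact ⟨u, q, hq, hu, h1, h2.elim id fun h => h.trans hn.le⟩

/-- Closeness to the identity in the topology of pointwise convergence. -/
theorem id_mem_closure_iff {X : Type*} [MetricSpace X] (G : Set (X → X)) :
    id ∈ closure G ↔ ∀ (P : Finset X) (ε : ℝ), 0 < ε → ∃ g ∈ G, ∀ p ∈ P, dist (g p) p < ε := by
  rw [mem_closure_iff_nhds]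
  constructor
  · intro h P ε hε
    obtain ⟨g, hg, hgG⟩ := h ((P : Set X).pi fun p => ball p ε)
      (set_pi_mem_nhds P.finite_toSet fun p _ => ball_mem_nhds _ hε)
    exact ⟨g, hgG, fun p hp => hg p hp⟩
  · intro h U hU
    rw [nhds_pi, Filter.mem_pi] at hU
    obtain ⟨I, hI, t, ht, hU⟩ := hU
    choose ε hε ht using fun p => Metric.mem_nhds_iff.1 (ht p)
    obtain ⟨δ, hδ, hδε⟩ : ∃ δ > 0, ∀ p ∈ I, δ ≤ ε p := by
      obtain rfl | hne := I.eq_empty_or_nonempty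
      · exact ⟨1, one_pos, by simp⟩
      · obtain ⟨p, -, hp⟩ := I.exists_min_image ε hI hne
        exact ⟨ε p, hε p, hp⟩
    obtain ⟨g, hgG, hg⟩ := h hI.toFinset δ hδ
    refine ⟨g, hU fun p hp => ht p ?_, hgG⟩
    exact (hg p (by simpa using hp)).trans_le (hδε p hp)

section SelfSimilar

variable {d : ℕ} {ι : Type*} {S : ι → EuclideanSpace ℝ (Fin d) → EuclideanSpace ℝ (Fin d)}
  {c : ι → ℝ} {m M : ℝ} {F : Set (EuclideanSpace ℝ (Fin d))}

/-- Under the weak separation property, the part of a self-similar set inside a ball is covered by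
a bounded number of cylinders of size comparable to the radius. -/
theorem SatisfiesWSP.exists_card_le (hW : SatisfiesWSP S)
    (hsim : ∀ i x y, dist (S i x) (S i y) = c i * dist x y)
    (hF : F = ⋃ i, S i '' F) (hFb : Bornology.IsBounded F)
    (hm : 0 < m) (hM : M < 1) (hmc : ∀ i, m ≤ c i) (hcM : ∀ i, c i ≤ M) :
    ∃ N : ℕ, ∀ (x : EuclideanSpace ℝ (Fin d)) (b : ℝ), 0 < b → b < 1 →
      ∃ W : Finset (List ι), W.card ≤ N ∧ (∀ u ∈ W, m * b ≤ wordRatio c u ∧ wordRatio c u ≤ b) ∧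
        F ∩ ball x (2 * b) ⊆ ⋃ u ∈ W, wordMap S u '' F := by
  classical
  have hc : ∀ i, 0 < c i := fun i => hm.trans_le (hmc i)
  unfold SatisfiesWSP at hW
  rw [id_mem_closure_iff] at hW
  push Not at hW
  obtain ⟨P, ε, hε, hP⟩ := hW
  obtain ⟨R, hR⟩ := (hFb.union P.finite_toSet.isBounded).subset_closedBall 0
  set R' := 2 * R + 2 with hR'
  have hcpt : IsCompact (closedBall (0 : P → EuclideanSpace ℝ (Fin d)) R') :=
    isCompact_closedBall _ _
  obtain ⟨T, hT⟩ := hcpt.totallyBounded.exists_finset_cover (δ := ε * m / 2) (by positivity)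
  refine ⟨T.card, fun x b hb hb1 => ?_⟩
  set Φ : List ι → P → EuclideanSpace ℝ (Fin d) := fun u p => b⁻¹ • (wordMap S u p - x) with hΦ
  set Q : (P → EuclideanSpace ℝ (Fin d)) → List ι → Prop := fun y u =>
    (m * b ≤ wordRatio c u ∧ wordRatio c u ≤ b) ∧ Φ u ∈ ball y (ε * m / 2) with hQ
  set V : Finset (P → EuclideanSpace ℝ (Fin d)) := T.filter fun y => ∃ u, Q y u with hV
  have hch : ∀ y, ∃ u, y ∈ V → Q y u := fun y => by
    by_cases hy : y ∈ V
    · obtain ⟨u, hu⟩ := (Finset.mem_filter.1 hy).2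
      exact ⟨u, fun _ => hu⟩
    · exact ⟨[], fun h => absurd h hy⟩
  choose w hw using hch
  refine ⟨V.image w, Finset.card_image_le.trans (Finset.card_filter_le _ _), ?_, ?_⟩
  · intro u hu
    obtain ⟨y, hy, rfl⟩ := Finset.mem_image.1 hu
    exact (hw y hy).1
  rintro z ⟨hzF, hzx⟩
  obtain ⟨u, q, hq, rfl, hu1, hu2⟩ := exists_wordMap_eq hF hm hM hmc hcM hzF hb hb1.le
  have hΦu : Φ u ∈ closedBall (0 : P → EuclideanSpace ℝ (Fin d)) R' := by
    have hR0 : 0 ≤ R := dist_nonneg.trans (hR (Or.inl hq) : dist q 0 ≤ R)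
    rw [mem_closedBall_zero_iff, pi_norm_le_iff_of_nonneg (by positivity)]
    rintro ⟨p, hp⟩
    simp only [hΦ, norm_smul, norm_inv, Real.norm_of_nonneg hb.le]
    rw [inv_mul_le_iff₀ hb, ← dist_eq_norm]
    have h1 := dist_triangle (wordMap S u p) (wordMap S u q) x
    rw [dist_wordMap hsim] at h1
    have h2 : dist p q ≤ 2 * R := by
      have a1 : dist p 0 ≤ R := hR (Or.inr hp)
      have a2 : dist q 0 ≤ R := hR (Or.inl hq)
      linarith [dist_triangle_right p q 0]
    have h3 : wordRatio c u * dist p q ≤ b * (2 * R) :=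
      mul_le_mul hu2 h2 dist_nonneg hb.le
    rw [mem_ball] at hzx
    nlinarith
  obtain ⟨y, hy, huy⟩ := by simpa only [mem_iUnion, exists_prop] using hT hΦu
  have hyV : y ∈ V := Finset.mem_filter.2 ⟨hy, u, ⟨hu1, hu2⟩, huy⟩
  obtain ⟨⟨hv1, hv2⟩, hvy⟩ := hw y hyV
  refine mem_iUnion₂.2 ⟨w y, Finset.mem_image_of_mem _ hyV, q, hq, ?_⟩
  set v := w y
  by_contra hne
  have hvu : v ≠ u := fun h => hne (by rw [h])
  have hnil : ∀ w : List ι, wordRatio c w ≤ b → w ≠ [] := by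
    rintro w hw rfl
    simp only [wordRatio, List.map_nil, List.prod_nil] at hw
    linarith
  have hinv : ∀ z, wordMap S v (Function.invFun (wordMap S v) z) = z :=
    Function.rightInverse_invFun
      (surjective_of_dist_eq (wordRatio_pos hc v) (dist_wordMap hsim v))
  obtain ⟨p, hp, hεp⟩ := hP (Function.invFun (wordMap S v) ∘ wordMap S u)
    ⟨⟨v, u, hnil v hv2, hnil u hu2, hvu, rfl⟩, fun h => hne (by
      have := congrArg (wordMap S v) (congrFun h q)
      simpa [hinv] using this.symm)⟩
  have h1 : dist (Φ u) (Φ v) < ε * m := by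
    rw [mem_ball] at huy hvy
    linarith [dist_triangle_right (Φ u) (Φ v) y]
  have h2 : dist (Φ u ⟨p, hp⟩) (Φ v ⟨p, hp⟩) < ε * m := (dist_le_pi_dist _ _ _).trans_lt h1
  simp only [hΦ, dist_smul₀, norm_inv, Real.norm_of_nonneg hb.le, dist_sub_right] at h2
  rw [inv_mul_lt_iff₀ hb] at h2
  have h3 := dist_wordMap hsim v ((Function.invFun (wordMap S v) ∘ wordMap S u) p) p
  rw [comp_apply, hinv] at h3
  rw [comp_apply] at hεp
  have : m * b * ε ≤ wordRatio c v * dist (Function.invFun (wordMap S v) (wordMap S u p)) p :=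
    mul_le_mul hv1 hεp hε.le (wordRatio_pos hc v).le
  linarith

/-- Under the weak separation property, every exponent larger than the Hausdorff dimension is
admissible for the Assouad dimension. -/
theorem SatisfiesWSP.isAssouadExponent (hW : SatisfiesWSP S)
    (hsim : ∀ i x y, dist (S i x) (S i y) = c i * dist x y)
    (hF : F = ⋃ i, S i '' F) (hFc : IsCompact F) (hFne : F.Nonempty)
    (hm : 0 < m) (hM : M < 1) (hmc : ∀ i, m ≤ c i) (hcM : ∀ i, c i ≤ M)
    {t : ℝ} (ht : 0 < t) (h0 : μH[t] F = 0) : IsAssouadExponent F t := by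
  classical
  have hc : ∀ i, 0 < c i := fun i => hm.trans_le (hmc i)
  obtain ⟨N, hN⟩ := hW.exists_card_le hsim hF hFc.isBounded hm hM hmc hcM
  obtain ⟨I, x, r, hr, hI, hsum⟩ := hFc.exists_finite_cover_sum_rpow_le hFne ht h0
    (η := 1 / ((N : ℝ) + 1)) (by positivity)
  have hN1 : (0 : ℝ) < N + 1 := by positivity
  have hη1 : 1 / ((N : ℝ) + 1) ≤ 1 := by
    rw [div_le_one hN1]
    linarith [(Nat.cast_nonneg N : (0 : ℝ) ≤ N)]
  have hr1 : ∀ n ∈ I, r n ≤ 1 := fun n hn => by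
    have h1 : r n ^ t ≤ 1 := (Finset.single_le_sum (f := fun n => r n ^ t)
      (fun k _ => (Real.rpow_pos_of_pos (hr k) t).le) hn).trans (hsum.trans hη1)
    by_contra h
    exact absurd h1 (not_le.2 (Real.one_lt_rpow (not_le.1 h) ht))
  have hcov : ∀ n, ∃ W : Finset (List ι), n ∈ I → W.card ≤ N ∧
      (∀ u ∈ W, wordRatio c u ≤ r n / 2) ∧
      F ∩ ball (x n) (r n) ⊆ ⋃ u ∈ W, wordMap S u '' F := fun n => by
    by_cases hn : n ∈ I
    · obtain ⟨W, h1, h2, h3⟩ := hN (x n) (r n / 2) (by linarith [hr n]) (by linarith [hr1 n hn])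
      rw [mul_div_cancel₀ _ two_ne_zero] at h3
      exact ⟨W, fun _ => ⟨h1, fun u hu => (h2 u hu).2, h3⟩⟩
    · exact ⟨∅, fun h => absurd h hn⟩
  choose W hWc using hcov
  have hrt : ∀ n, 0 ≤ r n ^ t := fun n => (Real.rpow_pos_of_pos (hr n) t).le
  obtain ⟨K, hK, hbox⟩ := exists_cover_card_le_of_subset_iUnion_image (I.sigma W)
    (fun j => wordMap S j.2) (fun j => wordRatio c j.2)
    (fun j hj => by
      obtain ⟨h1, h2⟩ := Finset.mem_sigma.1 hj
      exact ⟨wordRatio_pos hc _, by linarith [(hWc _ h1).2.1 _ h2, hr1 _ h1]⟩)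
    (fun j _ a b => (dist_wordMap hsim _ a b).le) hFc.totallyBounded
    (fun p hp => by
      obtain ⟨n, hn, hpn⟩ := by simpa only [mem_iUnion, exists_prop] using hI hp
      obtain ⟨u, hu, hpu⟩ := by
        simpa only [mem_iUnion, exists_prop] using (hWc n hn).2.2 ⟨hp, hpn⟩
      exact mem_iUnion₂.2 ⟨⟨n, u⟩, Finset.mem_sigma.2 ⟨hn, hu⟩, hpu⟩) ht.le (by
    rw [Finset.sum_sigma]
    calc ∑ n ∈ I, ∑ u ∈ W n, wordRatio c u ^ t ≤ ∑ n ∈ I, (N + 1) * r n ^ t := by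
          refine Finset.sum_le_sum fun n hn => ?_
          calc ∑ u ∈ W n, wordRatio c u ^ t ≤ ∑ u ∈ W n, r n ^ t := by
                refine Finset.sum_le_sum fun u hu => ?_
                exact Real.rpow_le_rpow (wordRatio_pos hc u).le
                  (by linarith [(hWc n hn).2.1 u hu, hr n]) ht.le
            _ = (W n).card * r n ^ t := by rw [Finset.sum_const, nsmul_eq_mul]
            _ ≤ (N + 1) * r n ^ t := by
                refine mul_le_mul_of_nonneg_right ?_ (hrt n)
                exact_mod_cast (hWc n hn).1.trans (Nat.le_succ N)
      _ = (N + 1) * ∑ n ∈ I, r n ^ t := by rw [Finset.mul_sum]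
      _ ≤ (N + 1) * (1 / (N + 1)) := by gcongr
      _ = 1 := mul_one_div_cancel hN1.ne')
  refine ⟨ht.le, (N + 1) * K, by positivity, fun r ρ hρ hρr hr x _ => ?_⟩
  have hr0 : 0 < r := hρ.trans hρr
  obtain ⟨V, h1, h2, h3⟩ := hN x (r / 2) (by linarith) (by linarith)
  rw [mul_div_cancel₀ _ two_ne_zero] at h3
  obtain ⟨U, hU, hUc⟩ := hbox (ρ / r) (by positivity) (by rwa [div_lt_one hr0])
  refine ⟨V.biUnion fun u => U.image (wordMap S u), ?_, ?_⟩
  · intro p hp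
    obtain ⟨u, hu, q, hq, rfl⟩ := by simpa only [mem_iUnion, exists_prop] using h3 hp
    obtain ⟨y, hy, hqy⟩ := by simpa only [mem_iUnion, exists_prop] using hU hq
    refine mem_iUnion₂.2 ⟨wordMap S u y,
      Finset.mem_biUnion.2 ⟨u, hu, Finset.mem_image_of_mem _ hy⟩, ?_⟩
    rw [mem_ball] at hqy ⊢
    rw [dist_wordMap hsim]
    rw [lt_div_iff₀ hr0] at hqy
    nlinarith [mul_le_mul_of_nonneg_right (h2 u hu).2 (dist_nonneg (x := q) (y := y)),
      dist_nonneg (x := q) (y := y)]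
  · calc ((V.biUnion fun u => U.image (wordMap S u)).card : ℝ) ≤ V.card * U.card := by
          exact_mod_cast Finset.card_biUnion_le_card_mul V _ _ fun u _ => Finset.card_image_le
      _ ≤ (N + 1) * (K * (1 / (ρ / r)) ^ t) := by
          refine mul_le_mul ?_ hUc (Nat.cast_nonneg _) hN1.le
          exact_mod_cast h1.trans (Nat.le_succ N)
      _ = (N + 1) * K * (r / ρ) ^ t := by rw [one_div_div, mul_assoc]

theorem SatisfiesWSP.assouadDim_eq_dimH (hW : SatisfiesWSP S)
    (hsim : ∀ i x y, dist (S i x) (S i y) = c i * dist x y)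
    (hF : F = ⋃ i, S i '' F) (hFc : IsCompact F) (hFne : F.Nonempty)
    (hm : 0 < m) (hM : M < 1) (hmc : ∀ i, m ≤ c i) (hcM : ∀ i, c i ≤ M) :
    assouadDim F = (dimH F).toReal := by
  obtain ⟨s₀, hs₀⟩ := exists_isAssouadExponent F
  have hfin : dimH F ≠ ⊤ := ne_top_of_le_ne_top ENNReal.ofReal_ne_top (hs₀.dimH_le hFc)
  refine le_antisymm (le_of_forall_gt_imp_ge_of_dense fun t ht => ?_)
    (le_assouadDim hs₀ fun s hs => ENNReal.toReal_le_of_le_ofReal hs.1 (hs.dimH_le hFc))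
  have ht0 : 0 < t := ENNReal.toReal_nonneg.trans_lt ht
  refine assouadDim_le (hW.isAssouadExponent hsim hF hFc hFne hm hM hmc hcM ht0 ?_)
  have := hausdorffMeasure_of_dimH_lt (s := F) (d := t.toNNReal) (by
    change dimH F < ENNReal.ofReal t
    exact (ENNReal.lt_ofReal_iff_toReal_lt hfin).2 ht)
  rwa [Real.coe_toNNReal t ht0.le] at this

theorem EuclideanSpace.norm_map_le_sum {E : Type*} [NormedAddCommGroup E] [NormedSpace ℝ E]
    (B : EuclideanSpace ℝ (Fin d) →ₗ[ℝ] E) {τ : ℝ}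
    (hB : ∀ i, ‖B (EuclideanSpace.single i 1)‖ ≤ τ) (z : EuclideanSpace ℝ (Fin d)) :
    ‖B z‖ ≤ d * τ * ‖z‖ := by
  have hz : z = ∑ i, z i • EuclideanSpace.single i (1 : ℝ) := by
    simpa using ((EuclideanSpace.basisFun (Fin d) ℝ).sum_repr z).symm
  calc ‖B z‖ = ‖∑ i, z i • B (EuclideanSpace.single i 1)‖ := by
        conv_lhs => rw [hz]
        rw [map_sum]
        simp only [map_smul]
    _ ≤ ∑ i, ‖z i • B (EuclideanSpace.single i 1)‖ := norm_sum_le _ _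
    _ ≤ ∑ _i : Fin d, ‖z‖ * τ := by
        refine Finset.sum_le_sum fun i _ => ?_
        rw [norm_smul]
        exact mul_le_mul (PiLp.norm_apply_le z i) (hB i) (norm_nonneg _) (norm_nonneg _)
    _ = d * τ * ‖z‖ := by simp; ring

theorem EuclideanSpace.exists_norm_le_mul_abs {v : EuclideanSpace ℝ (Fin d)} (hv : v ≠ 0) :
    ∃ i, ‖v‖ ≤ (d + 1) * |v i| := by
  by_contra! h
  have h1 : ‖v‖ ≤ ∑ i, |v i| := by
    have hz : v = ∑ i, v i • EuclideanSpace.single i (1 : ℝ) := by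
      simpa using ((EuclideanSpace.basisFun (Fin d) ℝ).sum_repr v).symm
    calc ‖v‖ = ‖∑ i, v i • EuclideanSpace.single i (1 : ℝ)‖ := by rw [← hz]
      _ ≤ ∑ i, ‖v i • EuclideanSpace.single i (1 : ℝ)‖ := norm_sum_le _ _
      _ = ∑ i, |v i| := by simp [norm_smul]
  have h2 : ∑ i, (d + 1) * |v i| ≤ ∑ _i : Fin d, ‖v‖ := Finset.sum_le_sum fun i _ => (h i).le
  rw [← Finset.mul_sum] at h2
  simp only [Finset.sum_const, Finset.card_univ, Fintype.card_fin, nsmul_eq_mul] at h2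
  nlinarith [norm_pos_iff.2 hv, (Nat.cast_nonneg d : (0 : ℝ) ≤ d)]

/-- If weak separation fails, there are maps `S_α⁻¹ ∘ S_β` whose displacement is small and nearly
constant, but nonzero at some point of the self-similar set. -/
theorem exists_near_id_of_not_satisfiesWSP (hW : ¬ SatisfiesWSP S)
    (hsim : ∀ i x y, dist (S i x) (S i y) = c i * dist x y) (hc : ∀ i, 0 < c i)
    (hFne : F.Nonempty) (hFspan : affineSpan ℝ F = ⊤) {τ : ℝ} (hτ : 0 < τ) :
    ∃ (α β : List ι) (g : EuclideanSpace ℝ (Fin d) → EuclideanSpace ℝ (Fin d)),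
      (∀ x, wordMap S α (g x) = wordMap S β x) ∧ ‖g 0‖ ≤ τ ∧
      (∀ x y, ‖(g x - x) - (g y - y)‖ ≤ τ * ‖x - y‖) ∧ ∃ p ∈ F, g p ≠ p := by
  classical
  unfold SatisfiesWSP at hW
  rw [not_not, id_mem_closure_iff] at hW
  set ε := τ / (2 * (d + 1)) with hε
  have hε0 : 0 < ε := by positivity
  have hd0 : (0 : ℝ) ≤ d := Nat.cast_nonneg d
  have hετ : 2 * (d + 1) * ε = τ := by rw [hε]; field_simp
  obtain ⟨g, ⟨⟨α, β, -, -, -, hg⟩, hgid⟩, hgP⟩ := hW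
    (insert 0 (Finset.univ.image fun i : Fin d => EuclideanSpace.single i (1 : ℝ))) ε hε0
  have hαg : ∀ x, wordMap S α (g x) = wordMap S β x := fun x => by
    rw [hg, comp_apply]
    exact Function.rightInverse_invFun
      (surjective_of_dist_eq (wordRatio_pos hc α) (dist_wordMap hsim α)) _
  have hα := wordRatio_pos hc α
  have hgsim : ∀ x y, dist (g x) (g y) = wordRatio c β / wordRatio c α * dist x y := by
    intro x y
    have h := dist_wordMap hsim α (g x) (g y)
    rw [hαg, hαg, dist_wordMap hsim β] at h
    rw [div_mul_eq_mul_div, h, mul_div_cancel_left₀ _ hα.ne']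
  set l := wordRatio c β / wordRatio c α
  obtain ⟨L, hL⟩ := exists_linearIsometryEquiv_of_dist_eq
    (div_pos (wordRatio_pos hc β) hα) hgsim
  set B : EuclideanSpace ℝ (Fin d) →ₗ[ℝ] EuclideanSpace ℝ (Fin d) :=
    l • L.toLinearEquiv.toLinearMap - LinearMap.id with hB_def
  have hB : ∀ x y, (g x - x) - (g y - y) = B (x - y) := fun x y => by
    rw [hL x, hL y]
    simp [hB_def, smul_sub]
    abel
  have hg0 : ‖g 0‖ < ε := by
    simpa using hgP 0 (Finset.mem_insert_self _ _)
  have hBi : ∀ i, ‖B (EuclideanSpace.single i 1)‖ ≤ 2 * ε := fun i => by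
    have h1 := hgP (EuclideanSpace.single i 1)
      (Finset.mem_insert_of_mem (Finset.mem_image_of_mem _ (Finset.mem_univ i)))
    rw [dist_eq_norm] at h1
    have h2 := hB (EuclideanSpace.single i 1) 0
    rw [sub_zero, sub_zero] at h2
    rw [← h2]
    linarith [norm_sub_le (g (EuclideanSpace.single i 1) - EuclideanSpace.single i 1) (g 0)]
  refine ⟨α, β, g, hαg, ?_, fun x y => ?_, ?_⟩
  · nlinarith
  · rw [hB]
    refine (EuclideanSpace.norm_map_le_sum B hBi _).trans ?_
    refine mul_le_mul_of_nonneg_right ?_ (norm_nonneg _)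
    nlinarith
  · by_contra! hfix
    obtain ⟨a, ha⟩ := hFne
    have hker : vectorSpan ℝ F ≤ LinearMap.ker B := by
      refine Submodule.span_le.2 ?_
      rintro _ ⟨x, hx, y, hy, rfl⟩
      change B (x - y) = 0
      rw [← hB, hfix x hx, hfix y hy]
      simp
    rw [← direction_affineSpan, hFspan, AffineSubspace.direction_top] at hker
    refine hgid (funext fun x => ?_)
    have h1 := hB x a
    rw [LinearMap.mem_ker.1 (hker Submodule.mem_top), hfix a ha, sub_self, sub_zero,
      sub_eq_zero] at h1
    exact h1

/-- The signed coordinates of a point of Euclidean space. -/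
def signedCoord (κ : Fin d × Bool) (x : EuclideanSpace ℝ (Fin d)) : ℝ :=
  if κ.2 then x κ.1 else -x κ.1

theorem signedCoord_add (κ : Fin d × Bool) (x y : EuclideanSpace ℝ (Fin d)) :
    signedCoord κ (x + y) = signedCoord κ x + signedCoord κ y := by
  unfold signedCoord
  split_ifs
  · simp
  · simp [add_comm]

theorem abs_signedCoord_le (κ : Fin d × Bool) (x : EuclideanSpace ℝ (Fin d)) :
    |signedCoord κ x| ≤ ‖x‖ := by
  unfold signedCoord
  split_ifs
  · exact PiLp.norm_apply_le x _
  · rw [abs_neg]; exact PiLp.norm_apply_le x _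

theorem exists_norm_le_mul_signedCoord {v : EuclideanSpace ℝ (Fin d)} (hv : v ≠ 0) :
    ∃ κ, ‖v‖ ≤ (d + 1) * signedCoord κ v := by
  obtain ⟨i, hi⟩ := EuclideanSpace.exists_norm_le_mul_abs hv
  rcases abs_cases (v i) with ⟨h, -⟩ | ⟨h, -⟩ <;> rw [h] at hi
  · exact ⟨(i, true), by simpa [signedCoord] using hi⟩
  · exact ⟨(i, false), by simpa [signedCoord] using hi⟩

/-- If weak separation fails, then for every word `w` and scale `η` some map
`(S_γ S_w)⁻¹ ∘ (S_δ S_w)` is close to a translation by a vector of length comparable to `η`. -/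
theorem exists_displacement_of_not_satisfiesWSP (hW : ¬ SatisfiesWSP S)
    (hsim : ∀ i x y, dist (S i x) (S i y) = c i * dist x y)
    (hF : F = ⋃ i, S i '' F) (hFb : Bornology.IsBounded F)
    (hFspan : affineSpan ℝ F = ⊤)
    (hm : 0 < m) (hm1 : m < 1) (hM : M < 1) (hmc : ∀ i, m ≤ c i) (hcM : ∀ i, c i ≤ M)
    {a : EuclideanSpace ℝ (Fin d)} (ha : a ∈ F) (w : List ι) {η : ℝ} (hη : 0 < η) :
    ∃ (γ δ : List ι) (h : EuclideanSpace ℝ (Fin d) → EuclideanSpace ℝ (Fin d)),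
      (∀ x, wordMap S (γ ++ w) (h x) = wordMap S (δ ++ w) x) ∧ ∃ κ, ∀ x ∈ closedBall a 1,
        ‖h x - x‖ ≤ η ∧ m / (4 * (d + 1)) * η ≤ signedCoord κ (h x - x) := by
  have hc : ∀ i, 0 < c i := fun i => hm.trans_le (hmc i)
  have hd1 : (0 : ℝ) < d + 1 := by positivity
  obtain ⟨R, hR⟩ := hFb.subset_closedBall 0
  have hR0 : 0 ≤ R := dist_nonneg.trans (hR ha : dist a 0 ≤ R)
  set cw := wordRatio c w with hcw
  have hcw0 : 0 < cw := wordRatio_pos hc w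
  set R' := 2 * R + cw with hR'
  have hR'0 : 0 < R' := by positivity
  set σ := m / (4 * (d + 1)) * η with hσ
  have hσ0 : 0 < σ := by positivity
  obtain ⟨τ, hτ, hτ1, hτ2⟩ : ∃ τ : ℝ, 0 < τ ∧ τ * R' ≤ cw * σ ∧
      2 * (τ * (1 + R)) ≤ m * (cw * η) := by
    refine ⟨min (cw * σ / R') (m * (cw * η) / (2 * (1 + R))), by positivity, ?_, ?_⟩
    · rw [← le_div_iff₀ hR'0]
      exact min_le_left _ _
    · have := (le_div_iff₀ (by positivity : 0 < 2 * (1 + R))).1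
        (min_le_right (cw * σ / R') (m * (cw * η) / (2 * (1 + R))))
      linarith
  obtain ⟨α, β, g, hg, hg0, hgD, p, hp, hgp⟩ :=
    exists_near_id_of_not_satisfiesWSP hW hsim hc ⟨a, ha⟩ hFspan hτ
  set D : EuclideanSpace ℝ (Fin d) → EuclideanSpace ℝ (Fin d) := fun x => g x - x with hD
  have hDp0 : 0 < ‖D p‖ := norm_pos_iff.2 (sub_ne_zero.2 hgp)
  have hDp : ‖D p‖ ≤ τ * (1 + R) := by
    have h1 := hgD p 0
    rw [sub_zero, sub_zero] at h1
    have h2 : ‖p‖ ≤ R := by simpa using hR hp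
    have h3 := norm_le_norm_add_norm_sub' (D p) (g 0)
    nlinarith
  set b := 2 * ‖D p‖ / (m * (cw * η)) with hb
  have hb0 : 0 < b := by positivity
  have hb1 : b ≤ 1 := by
    rw [hb, div_le_one (by positivity)]
    linarith
  obtain ⟨u, q, hq, hup, hu1, hu2⟩ := exists_wordMap_eq hF hm hM hmc hcM hp hb0 hb1
  have hu0 : 0 < wordRatio c u := wordRatio_pos hc u
  set cu := wordRatio c u with hcu
  have hcV : wordRatio c (u ++ w) = cu * cw := wordRatio_append c u w
  obtain ⟨L, hL⟩ := exists_linearIsometryEquiv_of_dist_eq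
    (wordRatio_pos hc (u ++ w)) (dist_wordMap hsim (u ++ w))
  rw [hcV] at hL
  set V := wordMap S (u ++ w) with hV
  have hcV0 : 0 < cu * cw := mul_pos hu0 hcw0
  set ψ : EuclideanSpace ℝ (Fin d) → EuclideanSpace ℝ (Fin d) :=
    fun y => (cu * cw)⁻¹ • L.symm y with hψ
  have hψn : ∀ y, ‖ψ y‖ = ‖y‖ / (cu * cw) := fun y => by
    rw [hψ, norm_smul, norm_inv, Real.norm_of_nonneg hcV0.le, LinearIsometryEquiv.norm_map,
      inv_mul_eq_div]
  have hψsub : ∀ y z, ψ (y - z) = ψ y - ψ z := fun y z => by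
    simp only [hψ, map_sub, smul_sub]
  have hVψ : ∀ x y, V (x + ψ y) = V x + y := fun x y => by
    rw [hL, hL x, map_add, smul_add, ← add_assoc]
    congr 1
    change (cu * cw) • L ((cu * cw)⁻¹ • L.symm y) = y
    rw [map_smul, L.apply_symm_apply, smul_inv_smul₀ hcV0.ne']
  have hclose : ∀ x ∈ closedBall a 1, ‖ψ (D (V x)) - ψ (D p)‖ ≤ σ := by
    intro x hx
    rw [← hψsub, hψn, div_le_iff₀ hcV0]
    have h1 : ‖V x - p‖ ≤ cu * R' := by
      rw [← dist_eq_norm, hV, ← hup, wordMap_append, dist_wordMap hsim]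
      refine mul_le_mul_of_nonneg_left ?_ hu0.le
      have h2 : dist (wordMap S w x) (wordMap S w a) ≤ cw := by
        rw [dist_wordMap hsim]
        exact mul_le_of_le_one_right hcw0.le hx
      have h3 : dist (wordMap S w a) 0 ≤ R := hR (wordMap_mem hF w ha)
      have h4 : dist q 0 ≤ R := hR hq
      linarith [dist_triangle (wordMap S w x) (wordMap S w a) q,
        dist_triangle_right (wordMap S w a) q 0]
    calc ‖D (V x) - D p‖ ≤ τ * ‖V x - p‖ := hgD _ _
      _ ≤ τ * (cu * R') := by gcongr
      _ = cu * (τ * R') := by ring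
      _ ≤ cu * (cw * σ) := by gcongr
      _ = σ * (cu * cw) := by ring
  have hmb : m * b * (cw * η) = 2 * ‖D p‖ := by
    rw [hb]
    field_simp
  have hv1 : ‖ψ (D p)‖ ≤ η / 2 := by
    rw [hψn, div_le_iff₀ hcV0]
    nlinarith [mul_le_mul_of_nonneg_right hu1 (by positivity : 0 ≤ cw * η)]
  have hv2 : m * η / 2 ≤ ‖ψ (D p)‖ := by
    rw [hψn, le_div_iff₀ hcV0]
    nlinarith [mul_le_mul_of_nonneg_right hu2 (by positivity : 0 ≤ m * (cw * η))]
  have hψ0 : ψ (D p) ≠ 0 := norm_pos_iff.1 (lt_of_lt_of_le (by positivity) hv2)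
  obtain ⟨κ, hκ⟩ := exists_norm_le_mul_signedCoord hψ0
  refine ⟨α ++ u, β ++ u, fun x => x + ψ (D (V x)), fun x => ?_, κ, fun x hx => ?_⟩
  · rw [List.append_assoc, List.append_assoc, wordMap_append, wordMap_append S β]
    change wordMap S α (V (x + ψ (D (V x)))) = wordMap S β (V x)
    rw [hVψ, ← hg (V x)]
    congr 1
    simp [hD]
  · have hx' := hclose x hx
    have hση : (d + 1) * σ = m * η / 4 := by
      rw [hσ]
      field_simp
    rw [add_sub_cancel_left]
    constructor
    · have h1 := norm_le_norm_add_norm_sub' (ψ (D (V x))) (ψ (D p))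
      have h2 : σ ≤ η / 4 := by
        nlinarith [(Nat.cast_nonneg d : (0 : ℝ) ≤ d)]
      linarith
    · have h1 := signedCoord_add κ (ψ (D p)) (ψ (D (V x)) - ψ (D p))
      rw [add_sub_cancel] at h1
      have h2 := (abs_le.1 (abs_signedCoord_le κ (ψ (D (V x)) - ψ (D p)))).1
      have h3 : 2 * σ ≤ signedCoord κ (ψ (D p)) := by
        have : (d + 1) * (2 * σ) ≤ (d + 1) * signedCoord κ (ψ (D p)) := by linarith
        exact le_of_mul_le_mul_left this hd1
      rw [h1]
      change σ ≤ _
      linarith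

/-- If weak separation fails, blow-ups of the self-similar set contain, for some signed coordinate,
arbitrarily long chains of points with increments comparable to `η`. -/
theorem exists_chain_of_not_satisfiesWSP (hW : ¬ SatisfiesWSP S)
    (hsim : ∀ i x y, dist (S i x) (S i y) = c i * dist x y)
    (hF : F = ⋃ i, S i '' F) (hFb : Bornology.IsBounded F)
    (hFspan : affineSpan ℝ F = ⊤)
    (hm : 0 < m) (hm1 : m < 1) (hM : M < 1) (hmc : ∀ i, m ≤ c i) (hcM : ∀ i, c i ≤ M)
    {a : EuclideanSpace ℝ (Fin d)} (ha : a ∈ F) {η : ℝ} (hη : 0 < η) (k : ℕ) (hk : k * η ≤ 1) :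
    ∃ (w : List ι) (n : Fin d × Bool → ℕ), ∑ κ, n κ = k ∧
      ∀ κ, ∃ q : ℕ → EuclideanSpace ℝ (Fin d), q 0 = a ∧
        (∀ j ≤ n κ, wordMap S w (q j) ∈ F) ∧
        ∀ j < n κ, ‖q (j + 1) - q j‖ ≤ η ∧
          m / (4 * (d + 1)) * η ≤ signedCoord κ (q (j + 1) - q j) := by
  classical
  induction k with
  | zero =>
    exact ⟨[], fun _ => 0, by simp, fun κ => ⟨fun _ => a, rfl, fun j _ => ha, by simp⟩⟩
  | succ k ih =>
    push_cast at hk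
    obtain ⟨w, n, hn, hq⟩ := ih (by linarith)
    obtain ⟨γ, δ, h, hh, κ₀, hκ₀⟩ := exists_displacement_of_not_satisfiesWSP hW hsim hF hFb hFspan
      hm hm1 hM hmc hcM ha w hη
    refine ⟨γ ++ w, Function.update n κ₀ (n κ₀ + 1), ?_, fun κ => ?_⟩
    · rw [Finset.sum_update_of_mem (Finset.mem_univ _), ← hn,
        ← Finset.add_sum_erase _ _ (Finset.mem_univ κ₀), Finset.sdiff_singleton_eq_erase]
      ring
    obtain ⟨q, hq0, hqF, hqd⟩ := hq κ
    have hqE : ∀ j ≤ n κ, wordMap S (γ ++ w) (q j) ∈ F := fun j hj => by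
      rw [wordMap_append]
      exact wordMap_mem hF γ (hqF j hj)
    by_cases hκ : κ = κ₀
    · subst hκ
      rw [Function.update_self]
      have hdist : ∀ j ≤ n κ, dist (q j) a ≤ j * η := by
        intro j
        induction j with
        | zero => intro _; simp [hq0]
        | succ j ihj =>
          intro hj
          have h1 := ihj (by omega)
          have h2 := (hqd j (by omega)).1
          rw [← dist_eq_norm] at h2
          push_cast
          linarith [dist_triangle (q (j + 1)) (q j) a]
      have hnk : (n κ : ℝ) ≤ k := by
        rw [← hn]
        exact_mod_cast Finset.single_le_sum (f := n) (fun _ _ => Nat.zero_le _)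
          (Finset.mem_univ κ)
      have hball : q (n κ) ∈ closedBall a 1 := (hdist _ le_rfl).trans (by nlinarith)
      refine ⟨fun j => if j ≤ n κ then q j else h (q (n κ)), by simp [hq0], fun j hj => ?_,
        fun j hj => ?_⟩
      · dsimp only
        split_ifs with hjn
        · exact hqE j hjn
        · rw [hh, wordMap_append]
          exact wordMap_mem hF δ (hqF _ le_rfl)
      · dsimp only
        rw [if_pos (show j ≤ n κ by omega)]
        split_ifs with hjn
        · exact hqd j hjn
        · obtain rfl : j = n κ := by omega
          exact hκ₀ _ hball
    · rw [Function.update_of_ne hκ]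
      exact ⟨q, hq0, hqE, hqd⟩

/-- If weak separation fails, every admissible exponent for the Assouad dimension is at least
one. -/
theorem IsAssouadExponent.one_le_of_not_satisfiesWSP {s : ℝ} (hs : IsAssouadExponent F s)
    (hW : ¬ SatisfiesWSP S)
    (hsim : ∀ i x y, dist (S i x) (S i y) = c i * dist x y)
    (hF : F = ⋃ i, S i '' F) (hFb : Bornology.IsBounded F) (hFne : F.Nonempty)
    (hFspan : affineSpan ℝ F = ⊤)
    (hm : 0 < m) (hm1 : m < 1) (hM : M < 1) (hmc : ∀ i, m ≤ c i) (hcM : ∀ i, c i ≤ M) : 1 ≤ s := by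
  obtain ⟨a, ha⟩ := hFne
  obtain ⟨hs0, K, hK, hcov⟩ := hs
  have hc : ∀ i, 0 < c i := fun i => hm.trans_le (hmc i)
  set c' := m / (4 * ((d : ℝ) + 1)) with hc'
  have hc'0 : 0 < c' := by positivity
  have key : ∀ N : ℕ, 0 < N → (N : ℝ) ≤ K * (4 / c') ^ s * (N : ℝ) ^ s := by
    intro N hN
    have hN0 : (0 : ℝ) < N := by exact_mod_cast hN
    set k := (Fintype.card (Fin d × Bool)) * N + N with hkdef
    have hNk : (N : ℝ) ≤ k := by rw [hkdef]; exact_mod_cast Nat.le_add_left _ _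
    have hk0 : (0 : ℝ) < k := hN0.trans_le hNk
    set η : ℝ := 1 / (2 * k) with hη
    have hη0 : 0 < η := by positivity
    have hkη : k * η = 1 / 2 := by rw [hη]; field_simp
    obtain ⟨w, n, hn, hq⟩ := exists_chain_of_not_satisfiesWSP hW hsim hF hFb hFspan hm hm1 hM hmc hcM
      ha hη0 k (by linarith)
    obtain ⟨κ, hκ⟩ : ∃ κ, N ≤ n κ := by
      by_contra! hlt
      have : ∑ κ, n κ ≤ ∑ _κ : Fin d × Bool, N := Finset.sum_le_sum fun κ _ => (hlt κ).le
      rw [hn, Finset.sum_const, Finset.card_univ, smul_eq_mul] at this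
      omega
    obtain ⟨q, hq0, hqF, hqd⟩ := hq κ
    have hdist : ∀ j ≤ N, dist (q j) (q 0) ≤ j * η := by
      intro j
      induction j with
      | zero => intro _; simp
      | succ j ihj =>
        intro hj
        have h1 := ihj (by omega)
        have h2 := (hqd j (by omega)).1
        rw [← dist_eq_norm] at h2
        push_cast
        linarith [dist_triangle (q (j + 1)) (q j) (q 0)]
    have hsep : ∀ i j, i < j → j ≤ N → c' * η ≤ signedCoord κ (q j - q i) := by
      intro i j hij
      induction j, hij using Nat.le_induction with
      | base => exact fun hj => (hqd i (by omega)).2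
      | succ j hij ihj =>
        intro hj
        have h1 := ihj (by omega)
        have h2 := (hqd j (by omega)).2
        have h3 := signedCoord_add κ (q (j + 1) - q j) (q j - q i)
        rw [sub_add_sub_cancel] at h3
        nlinarith [mul_pos hc'0 hη0]
    have hsep' : ∀ i ≤ N, ∀ j ≤ N, i ≠ j → c' * η ≤ dist (q i) (q j) := by
      intro i hi j hj hij
      rcases lt_or_gt_of_ne hij with h | h
      · rw [dist_comm, dist_eq_norm]
        exact (hsep i j h hj).trans ((le_abs_self _).trans (abs_signedCoord_le κ _))
      · rw [dist_eq_norm]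
        exact (hsep j i h hi).trans ((le_abs_self _).trans (abs_signedCoord_le κ _))
    set cw := wordRatio c w with hcw
    have hcw0 : 0 < cw := wordRatio_pos hc w
    have hcw1 : cw ≤ 1 := wordRatio_le_one (fun i => (hc i).le) (fun i => (hcM i).trans hM.le) w
    have hr1 : cw * (2 * N * η) ≤ 1 :=
      mul_le_one₀ hcw1 (by positivity) (by nlinarith)
    have hc'1 : c' ≤ 1 := by
      rw [hc', div_le_one (by positivity)]
      linarith [(Nat.cast_nonneg d : (0 : ℝ) ≤ d)]
    have hN1 : (1 : ℝ) ≤ N := by exact_mod_cast hN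
    obtain ⟨T, hT, hTc⟩ := hcov (cw * (2 * N * η)) (cw * (c' / 2 * η)) (by positivity)
      (by gcongr; linarith) hr1 (wordMap S w (q 0)) (hqF 0 (Nat.zero_le _))
    have hex : ∀ j, ∃ y, j ≤ N → y ∈ T ∧ dist (wordMap S w (q j)) y < cw * (c' / 2 * η) := by
      intro j
      by_cases hj : j ≤ N
      · have hmem : wordMap S w (q j) ∈ ball (wordMap S w (q 0)) (cw * (2 * N * η)) := by
          rw [mem_ball, dist_wordMap hsim]
          refine mul_lt_mul_of_pos_left ((hdist j hj).trans_lt ?_) hcw0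
          have hjN : (j : ℝ) ≤ N := by exact_mod_cast hj
          nlinarith
        obtain ⟨y, hy, hjy⟩ := by
          simpa only [mem_iUnion, exists_prop] using hT ⟨hqF j (hj.trans hκ), hmem⟩
        exact ⟨y, fun _ => ⟨hy, hjy⟩⟩
      · exact ⟨a, fun h => absurd h hj⟩
    choose y hy using hex
    have hcard : (Finset.range (N + 1)).card ≤ T.card := by
      refine Finset.card_le_card_of_injOn y
        (fun j hj => (hy j (Nat.lt_succ_iff.1 (by simpa using hj))).1) ?_
      intro i hi j hj hij
      have hi : i ≤ N := Nat.lt_succ_iff.1 (by simpa using hi)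
      have hj : j ≤ N := Nat.lt_succ_iff.1 (by simpa using hj)
      by_contra hne
      have h1 := (hy i hi).2
      have h2 := (hy j hj).2
      rw [← hij] at h2
      have h3 := dist_triangle_right (wordMap S w (q i)) (wordMap S w (q j)) (y i)
      rw [dist_wordMap hsim] at h3
      have h4 := mul_le_mul_of_nonneg_left (hsep' i hi j hj hne) hcw0.le
      linarith
    rw [Finset.card_range] at hcard
    have hratio : cw * (2 * N * η) / (cw * (c' / 2 * η)) = 4 / c' * N := by
      field_simp
      ring
    rw [hratio, Real.mul_rpow (by positivity) hN0.le, ← mul_assoc] at hTc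
    refine le_trans ?_ hTc
    exact_mod_cast (Nat.le_succ N).trans hcard
  by_contra! hs1
  have hlim := (tendsto_rpow_atTop (sub_pos.2 hs1)).comp
    (tendsto_natCast_atTop_atTop (R := ℝ))
  obtain ⟨N, hN, hN0⟩ := ((hlim.eventually_gt_atTop (K * (4 / c') ^ s)).and
    (eventually_gt_atTop 0)).exists
  have hN0' : (0 : ℝ) < N := by exact_mod_cast hN0
  have h1 := key N hN0
  have h2 := mul_lt_mul_of_pos_right hN (Real.rpow_pos_of_pos hN0' s)
  rw [comp_apply, ← Real.rpow_add hN0', sub_add_cancel, Real.rpow_one] at h2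
  linarith

end SelfSimilar

/-- **Dichotomy for self-similar subsets of `ℝ^d`.**  Let `F` be a self-similar set in
`ℝ^d`, attractor of an IFS of contracting similarities, not contained in any
`(d-1)`-dimensional hyperplane (i.e. its affine span is everything).  If the IFS
satisfies the weak separation property then the Assouad dimension of `F` equals its
Hausdorff dimension; otherwise the Assouad dimension of `F` is at least `1`. -/
theorem assouad_dichotomy_Rd {d : ℕ} {ι : Type} [Fintype ι] [Nonempty ι]
    (S : ι → EuclideanSpace ℝ (Fin d) → EuclideanSpace ℝ (Fin d)) (c : ι → ℝ)
    (hc : ∀ i, c i ∈ Set.Ioo (0 : ℝ) 1)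
    (hsim : ∀ i x y, dist (S i x) (S i y) = c i * dist x y)
    (F : Set (EuclideanSpace ℝ (Fin d))) (hFcomp : IsCompact F) (hFne : F.Nonempty)
    (hFattr : F = ⋃ i, S i '' F)
    (hFspan : affineSpan ℝ F = ⊤) :
    (SatisfiesWSP S → assouadDim F = (dimH F).toReal) ∧
    (¬ SatisfiesWSP S → 1 ≤ assouadDim F) := by
  obtain ⟨im, hm⟩ := Finite.exists_min c
  obtain ⟨iM, hM⟩ := Finite.exists_max c
  refine ⟨fun hW => hW.assouadDim_eq_dimH hsim hFattr hFcomp hFne (hc im).1 (hc iM).2 hm hM,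
    fun hW => ?_⟩
  obtain ⟨s₀, hs₀⟩ := exists_isAssouadExponent F
  exact le_assouadDim hs₀ fun s hs => hs.one_le_of_not_satisfiesWSP hW hsim hFattr
    hFcomp.isBounded hFne hFspan (hc im).1 (hc im).2 (hc iM).2 hm hM
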